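/- The full Metropolis–Hastings transition kernel of EBD leaves the reward-tilted target invariant: defining K(y, y') = Q(y' ∣ y)·α(y, y') for y' ≠ y and K(y, y) = Q(y ∣ y) + Σ_{z ≠ y} Q(z ∣ y)·(1 − α(y, z)), where α(y, y') = min(1, exp(β·(S(y') − S(y)))), one has Σ_{y ∈ Y} π_β(y)·K(y, y') = π_β(y') for every y' ∈ Y. -/

import Mathlib

open Finset

/-- `y` and `y'` agree below the cut position `c`. -/
def agreeBelow {T : Type*} (L : ℕ) (c : Fin (L + 1)) (y y' : Fin L → T) : Prop :=
  ∀ i : Fin L, (i : ℕ) < (c : ℕ) → y i = y' i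

instance {T : Type*} [DecidableEq T] (L : ℕ) (c : Fin (L + 1)) (y y' : Fin L → T) :
    Decidable (agreeBelow L c y y') := by
  unfold agreeBelow; infer_instance

/-- Prefix marginal `m_c(y) = Σ_{z agreeing with y below c} p(z)`. -/
noncomputable def prefixMarginal {T : Type*} [Fintype T] [DecidableEq T] (L : ℕ)
    (p : (Fin L → T) → ℝ) (c : Fin (L + 1)) (y : Fin L → T) : ℝ :=
  ∑ z : Fin L → T, if agreeBelow L c y z then p z else 0

/-- Suffix-regeneration proposal `Q_c(y' ∣ y)`:  `Qc L p c y y'` is the probability of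
proposing `y'` from current state `y` with cut `c`. -/
noncomputable def Qc {T : Type*} [Fintype T] [DecidableEq T] (L : ℕ)
    (p : (Fin L → T) → ℝ) (c : Fin (L + 1)) (y y' : Fin L → T) : ℝ :=
  if agreeBelow L c y y' then p y' / prefixMarginal L p c y else 0

/-- Cut-mixture proposal `Q(y' ∣ y) = Σ_c P(c) · Q_c(y' ∣ y)`. -/
noncomputable def Qmix {T : Type*} [Fintype T] [DecidableEq T] (L : ℕ)
    (p : (Fin L → T) → ℝ) (P : Fin (L + 1) → ℝ) (y y' : Fin L → T) : ℝ :=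
  ∑ c : Fin (L + 1), P c * Qc L p c y y'

/-- Partition function `Z_β = Σ_y p(y) · exp(β · S(y))`. -/
noncomputable def Zbeta {Y : Type*} [Fintype Y] (p : Y → ℝ) (S : Y → ℝ) (β : ℝ) : ℝ :=
  ∑ y, p y * Real.exp (β * S y)

/-- Reward-tilted distribution `π_β(y) = p(y) · exp(β · S(y)) / Z_β`. -/
noncomputable def piBeta {Y : Type*} [Fintype Y] (p : Y → ℝ) (S : Y → ℝ) (β : ℝ) (y : Y) : ℝ :=
  p y * Real.exp (β * S y) / Zbeta p S β

/-- Reward-comparison Metropolis–Hastings acceptance probability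
`α(y, y') = min(1, exp(β · (S(y') − S(y))))`. -/
noncomputable def accept {Y : Type*} (β : ℝ) (S : Y → ℝ) (y y' : Y) : ℝ :=
  min 1 (Real.exp (β * (S y' - S y)))

/-- Full Metropolis–Hastings transition kernel: `K(y, y') = Q(y' ∣ y) · α(y, y')` for `y' ≠ y`,
and `K(y, y) = Q(y ∣ y) + Σ_{z ≠ y} Q(z ∣ y) · (1 − α(y, z))`. -/
noncomputable def mhKernel {Y : Type*} [Fintype Y] [DecidableEq Y]
    (Q : Y → Y → ℝ) (β : ℝ) (S : Y → ℝ) (y y' : Y) : ℝ :=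
  if y' = y then
    Q y y + ∑ z ∈ Finset.univ.filter (fun z => z ≠ y), Q y z * (1 - accept β S y z)
  else
    Q y y' * accept β S y y'

theorem agreeBelow_comm {T : Type*} {L : ℕ} {c : Fin (L + 1)} {y y' : Fin L → T} :
    agreeBelow L c y y' ↔ agreeBelow L c y' y :=
  ⟨fun h i hi => (h i hi).symm, fun h i hi => (h i hi).symm⟩

theorem agreeBelow.trans {T : Type*} {L : ℕ} {c : Fin (L + 1)} {x y z : Fin L → T}
    (hxy : agreeBelow L c x y) (hyz : agreeBelow L c y z) : agreeBelow L c x z :=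
  fun i hi => (hxy i hi).trans (hyz i hi)

section Proposal

variable {T : Type*} [Fintype T] [DecidableEq T] {L : ℕ} {p : (Fin L → T) → ℝ}

theorem prefixMarginal_congr {c : Fin (L + 1)} {y y' : Fin L → T}
    (h : agreeBelow L c y y') : prefixMarginal L p c y = prefixMarginal L p c y' := by
  unfold prefixMarginal
  refine Finset.sum_congr rfl fun z _ => ?_
  have hiff : agreeBelow L c y z ↔ agreeBelow L c y' z :=
    ⟨(agreeBelow_comm.1 h).trans, h.trans⟩
  simp only [hiff]

theorem prefixMarginal_pos (hp : ∀ y, 0 < p y) (c : Fin (L + 1)) (y : Fin L → T) :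
    0 < prefixMarginal L p c y := by
  refine Finset.sum_pos' (fun z _ => ?_) ⟨y, Finset.mem_univ y, ?_⟩
  · split_ifs
    exacts [(hp z).le, le_rfl]
  · rw [if_pos (show agreeBelow L c y y from fun _ _ => rfl)]
    exact hp y

theorem sum_Qc (hp : ∀ y, 0 < p y) (c : Fin (L + 1)) (y : Fin L → T) :
    ∑ y', Qc L p c y y' = 1 := by
  have h : ∀ y', Qc L p c y y' =
      (if agreeBelow L c y y' then p y' else 0) / prefixMarginal L p c y := fun y' => by
    unfold Qc
    split_ifs <;> simp
  simp only [h, ← Finset.sum_div]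
  exact div_self (prefixMarginal_pos hp c y).ne'

theorem mul_Qc_comm (c : Fin (L + 1)) (y y' : Fin L → T) :
    p y * Qc L p c y y' = p y' * Qc L p c y' y := by
  unfold Qc
  by_cases h : agreeBelow L c y y'
  · rw [if_pos h, if_pos (agreeBelow_comm.1 h), prefixMarginal_congr h]
    ring
  · rw [if_neg h, if_neg (mt agreeBelow_comm.1 h), mul_zero, mul_zero]

theorem sum_Qmix (hp : ∀ y, 0 < p y) {P : Fin (L + 1) → ℝ} (hP : ∑ c, P c = 1)
    (y : Fin L → T) : ∑ y', Qmix L p P y y' = 1 := by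
  unfold Qmix
  rw [Finset.sum_comm]
  simp only [← Finset.mul_sum, sum_Qc hp, mul_one, hP]

theorem mul_Qmix_comm (P : Fin (L + 1) → ℝ) (y y' : Fin L → T) :
    p y * Qmix L p P y y' = p y' * Qmix L p P y' y := by
  unfold Qmix
  simp only [Finset.mul_sum, mul_left_comm _ (P _), mul_Qc_comm _ y y']

end Proposal

theorem exp_mul_accept {Y : Type*} (β : ℝ) (S : Y → ℝ) (y y' : Y) :
    Real.exp (β * S y) * accept β S y y' =
      min (Real.exp (β * S y)) (Real.exp (β * S y')) := by
  unfold accept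
  rw [mul_min_of_nonneg _ _ (Real.exp_pos _).le, mul_one, ← Real.exp_add]
  congr 3
  ring

section Kernel

variable {Y : Type*} [Fintype Y] [DecidableEq Y] {Q : Y → Y → ℝ} {β : ℝ} {S : Y → ℝ}

/-- The Metropolis–Hastings kernel preserves the total mass of each row of the proposal. -/
theorem sum_mhKernel (y : Y) : ∑ y', mhKernel Q β S y y' = ∑ y', Q y y' := by
  have hoff : ∑ z ∈ Finset.univ.erase y, mhKernel Q β S y z =
      ∑ z ∈ Finset.univ.erase y, Q y z * accept β S y z :=
    Finset.sum_congr rfl fun z hz => if_neg (Finset.ne_of_mem_erase hz)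
  rw [← Finset.add_sum_erase _ _ (Finset.mem_univ y), hoff,
    ← Finset.add_sum_erase _ (Q y) (Finset.mem_univ y), mhKernel, if_pos rfl,
    Finset.filter_ne', add_assoc, ← Finset.sum_add_distrib]
  congr 1
  exact Finset.sum_congr rfl fun z _ => by ring

/-- Detailed balance with respect to the tilted distribution, for a proposal that is
reversible with respect to the prior. -/
theorem piBeta_mul_mhKernel_comm {p : Y → ℝ} (hQ : ∀ y y', p y * Q y y' = p y' * Q y' y)
    (y y' : Y) :
    piBeta p S β y * mhKernel Q β S y y' = piBeta p S β y' * mhKernel Q β S y' y := by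
  rcases eq_or_ne y' y with rfl | h
  · rfl
  · rw [mhKernel, if_neg h, mhKernel, if_neg h.symm, piBeta, piBeta]
    calc p y * Real.exp (β * S y) / Zbeta p S β * (Q y y' * accept β S y y')
        = p y * Q y y' * (Real.exp (β * S y) * accept β S y y') / Zbeta p S β := by ring
      _ = p y' * Q y' y * (Real.exp (β * S y') * accept β S y' y) / Zbeta p S β := by
        rw [hQ, exp_mul_accept, exp_mul_accept, min_comm]
      _ = _ := by ring

end Kernel

/-- The full Metropolis–Hastings transition kernel of EBD leaves the
reward-tilted target invariant. -/
theorem mh_kernel_stationary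
    {T : Type*} [Fintype T] [DecidableEq T] [Nonempty T] {L : ℕ} (hL : 0 < L)
    (p : (Fin L → T) → ℝ) (hp_pos : ∀ y, 0 < p y) (hp_sum : ∑ y, p y = 1)
    (P : Fin (L + 1) → ℝ) (hP_nonneg : ∀ c, 0 ≤ P c) (hP_sum : ∑ c, P c = 1)
    (S : (Fin L → T) → ℝ) (β : ℝ) (hβ : 0 < β) :
    ∀ y' : Fin L → T,
      ∑ y : Fin L → T, piBeta p S β y * mhKernel (Qmix L p P) β S y y'
        = piBeta p S β y' := by
  intro y'
  simp only [piBeta_mul_mhKernel_comm (mul_Qmix_comm P) _ y']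
  rw [← Finset.mul_sum, sum_mhKernel, sum_Qmix hp_pos hP_sum, mul_one]
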